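/- Let p be a prime and let T be the commutative ring presented by generators n and t_v (v : ZMod p → ℕ) subject to the relations t_{0̄}² = p·t_{0̄}, t_v = t_{σv}, n·t_v = t_{v+1̄}, and t_v·t_w = Σ_{j=0}^{p−1} t_{v+σ^j w}. Then the quotient of T by the ideal generated by all t_v with v ≠ 0̄ is isomorphic as a ring to ℤ[n, t]/(t² − p·t, n·t), via the map sending the class of n to n and the class of t_{0̄} to t. -/

import Mathlib

/-!
STATEMENT 7: Let `p` be a prime and `T` the presented ring as above.  Then the quotient of `T`
by the ideal generated by all `t_v` with `v ≠ 0̄` is isomorphic as a ring to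
`ℤ[n, t]/(t² − p·t, n·t)`, via the map sending the class of `n` to `n` and the class of `t_0̄`
to `t`.
-/

/-- The shift action of `j : ZMod p` on exponent vectors: `(σʲ v) i = v (i - j)`. -/
def shiftVec (p : ℕ) (j : ZMod p) (v : ZMod p → ℕ) : ZMod p → ℕ :=
  fun i => v (i - j)

/-- The monomial `x^v = ∏ᵢ xᵢ^{v i}`. -/
noncomputable def expMonomial (p : ℕ) [NeZero p] (v : ZMod p → ℕ) :
    MvPolynomial (ZMod p) ℤ :=
  MvPolynomial.monomial (Finsupp.equivFunOnFinite.symm v) 1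

/-- The orbit sum `O(v) = Σ_{j = 0}^{p-1} x^{σʲ v}`. -/
noncomputable def orbitSum (p : ℕ) [NeZero p] (v : ZMod p → ℕ) :
    MvPolynomial (ZMod p) ℤ :=
  ∑ j : ZMod p, expMonomial p (shiftVec p j v)

/-- Generators of the presented ring `T`: `none` is the generator `n`, and `some v` is the
generator `t_v` for an exponent vector `v : ZMod p → ℕ`. -/
abbrev TGen (p : ℕ) : Type := Option (ZMod p → ℕ)

/-- The ideal of relations defining `T`:
`t_0̄² = p t_0̄`, `t_v = t_{σv}`, `n t_v = t_{v + 1̄}`, and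
`t_v t_w = Σ_{j=0}^{p-1} t_{v + σʲ w}`. -/
noncomputable def relIdeal (p : ℕ) [NeZero p] : Ideal (MvPolynomial (TGen p) ℤ) :=
  Ideal.span
    ({MvPolynomial.X (some (0 : ZMod p → ℕ)) ^ 2 -
        (p : MvPolynomial (TGen p) ℤ) * MvPolynomial.X (some (0 : ZMod p → ℕ))} ∪
      Set.range (fun v : ZMod p → ℕ =>
        MvPolynomial.X (some v) - MvPolynomial.X (some (shiftVec p 1 v))) ∪
      Set.range (fun v : ZMod p → ℕ =>
        MvPolynomial.X none * MvPolynomial.X (some v) - MvPolynomial.X (some (v + 1))) ∪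
      Set.range (fun vw : (ZMod p → ℕ) × (ZMod p → ℕ) =>
        MvPolynomial.X (some vw.1) * MvPolynomial.X (some vw.2) -
          ∑ j : ZMod p, MvPolynomial.X (some (vw.1 + shiftVec p j vw.2))))

/-- The presented commutative ring `T`: the value at the fixed level `C_p/C_p` of the free
`C_p`-Tambara functor on an underlying generator. -/
abbrev TRing (p : ℕ) [NeZero p] : Type := MvPolynomial (TGen p) ℤ ⧸ relIdeal p

/-- The image of `n` in `T`. -/
noncomputable def nElt (p : ℕ) [NeZero p] : TRing p :=
  Ideal.Quotient.mk (relIdeal p) (MvPolynomial.X none)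

/-- The image of `t_v` in `T`. -/
noncomputable def tElt (p : ℕ) [NeZero p] (v : ZMod p → ℕ) : TRing p :=
  Ideal.Quotient.mk (relIdeal p) (MvPolynomial.X (some v))


/-- The ideal of `T` generated by all `t_v` with `v ≠ 0̄`. -/
noncomputable def posIdeal (p : ℕ) [NeZero p] : Ideal (TRing p) :=
  Ideal.span (Set.range (fun v : {v : ZMod p → ℕ // v ≠ 0} => tElt p (v : ZMod p → ℕ)))

/-- The ring `ℤ[n, t]/(t² − p·t, n·t)`, with `false` as the variable `n` and `true` as the
variable `t`. -/
abbrev targetRing (p : ℕ) : Type :=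
  MvPolynomial Bool ℤ ⧸
    Ideal.span {MvPolynomial.X true ^ 2 - (p : MvPolynomial Bool ℤ) * MvPolynomial.X true,
      MvPolynomial.X false * MvPolynomial.X true}

theorem shiftVec_zero (p : ℕ) (j : ZMod p) : shiftVec p j 0 = 0 := rfl

theorem shiftVec_eq_zero_iff (p : ℕ) (j : ZMod p) (v : ZMod p → ℕ) :
    shiftVec p j v = 0 ↔ v = 0 := by
  refine ⟨fun h => funext fun i => ?_, fun h => h ▸ shiftVec_zero p j⟩
  simpa [shiftVec] using congrFun h (i + j)

open Classical in
/-- The values in `ℤ[n, t]/(t² − p·t, n·t)` of the generators of `T`. -/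
noncomputable def genValue (p : ℕ) : TGen p → targetRing p
  | none => Ideal.Quotient.mk _ (MvPolynomial.X false)
  | some v => if v = 0 then Ideal.Quotient.mk _ (MvPolynomial.X true) else 0

theorem genValue_none (p : ℕ) :
    genValue p none = Ideal.Quotient.mk _ (MvPolynomial.X false) := rfl

theorem genValue_zero (p : ℕ) :
    genValue p (some 0) = Ideal.Quotient.mk _ (MvPolynomial.X true) := by
  simp [genValue]

theorem genValue_of_ne_zero (p : ℕ) {v : ZMod p → ℕ} (hv : v ≠ 0) :
    genValue p (some v) = 0 := by
  simp [genValue, hv]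

theorem genValue_zero_sq (p : ℕ) :
    genValue p (some 0) ^ 2 = (p : targetRing p) * genValue p (some 0) := by
  rw [genValue_zero, ← map_natCast (Ideal.Quotient.mk _), ← map_pow, ← map_mul,
    Ideal.Quotient.mk_eq_mk_iff_sub_mem]
  exact Ideal.subset_span (by simp)

theorem genValue_none_mul_zero (p : ℕ) : genValue p none * genValue p (some 0) = 0 := by
  rw [genValue_none, genValue_zero, ← map_mul, Ideal.Quotient.eq_zero_iff_mem]
  exact Ideal.subset_span (by simp)

/-- The map `T → ℤ[n, t]/(t² − p·t, n·t)` that kills every `t_v` with `v ≠ 0̄`. -/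
noncomputable def toTarget (p : ℕ) [NeZero p] : TRing p →+* targetRing p :=
  Ideal.Quotient.lift (relIdeal p)
    (MvPolynomial.eval₂Hom (Int.castRingHom (targetRing p)) (genValue p)) <| by
    suffices h : relIdeal p ≤ RingHom.ker
        (MvPolynomial.eval₂Hom (Int.castRingHom (targetRing p)) (genValue p)) from
      fun a ha => h ha
    rw [relIdeal, Ideal.span_le]
    rintro _ (((rfl | ⟨v, rfl⟩) | ⟨v, rfl⟩) | ⟨⟨v, w⟩, rfl⟩) <;>
      simp only [SetLike.mem_coe, RingHom.mem_ker, map_sub, map_mul, map_pow, map_sum,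
        map_natCast, MvPolynomial.eval₂Hom_X', sub_eq_zero]
    · exact genValue_zero_sq p
    · by_cases hv : v = 0
      · rw [hv, shiftVec_zero]
      · rw [genValue_of_ne_zero p hv,
          genValue_of_ne_zero p (mt (shiftVec_eq_zero_iff p 1 v).1 hv)]
    · have h : v + 1 ≠ 0 := fun h => by simpa using congrFun h 0
      rw [genValue_of_ne_zero p h]
      by_cases hv : v = 0
      · rw [hv, genValue_none_mul_zero]
      · rw [genValue_of_ne_zero p hv, mul_zero]
    · by_cases hvw : v = 0 ∧ w = 0
      · obtain ⟨rfl, rfl⟩ := hvw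
        simp [shiftVec_zero, ← pow_two, genValue_zero_sq, ZMod.card]
      · have h (j : ZMod p) : v + shiftVec p j w ≠ 0 := by
          rwa [Ne, add_eq_zero, shiftVec_eq_zero_iff]
        rw [Finset.sum_eq_zero fun j _ => genValue_of_ne_zero p (h j)]
        by_cases hv : v = 0
        · rw [genValue_of_ne_zero p fun hw => hvw ⟨hv, hw⟩, mul_zero]
        · rw [genValue_of_ne_zero p hv, zero_mul]

theorem toTarget_nElt (p : ℕ) [NeZero p] : toTarget p (nElt p) = genValue p none :=
  MvPolynomial.eval₂Hom_X' _ _ _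

theorem toTarget_tElt (p : ℕ) [NeZero p] (v : ZMod p → ℕ) :
    toTarget p (tElt p v) = genValue p (some v) :=
  MvPolynomial.eval₂Hom_X' _ _ _

/-- The map `T / (t_v : v ≠ 0̄) → ℤ[n, t]/(t² − p·t, n·t)`. -/
noncomputable def quotientToTarget (p : ℕ) [NeZero p] :
    TRing p ⧸ posIdeal p →+* targetRing p :=
  Ideal.Quotient.lift (posIdeal p) (toTarget p) <| by
    suffices h : posIdeal p ≤ RingHom.ker (toTarget p) from fun a ha => h ha
    rw [posIdeal, Ideal.span_le]
    rintro _ ⟨⟨v, hv⟩, rfl⟩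
    simp only [SetLike.mem_coe, RingHom.mem_ker]
    rw [toTarget_tElt, genValue_of_ne_zero p hv]

theorem tElt_zero_sq (p : ℕ) [NeZero p] : tElt p 0 ^ 2 = (p : TRing p) * tElt p 0 := by
  rw [tElt, ← map_natCast (Ideal.Quotient.mk _), ← map_pow, ← map_mul,
    Ideal.Quotient.mk_eq_mk_iff_sub_mem]
  exact Ideal.subset_span (Or.inl (Or.inl (Or.inl rfl)))

theorem nElt_mul_tElt (p : ℕ) [NeZero p] (v : ZMod p → ℕ) :
    nElt p * tElt p v = tElt p (v + 1) := by
  rw [tElt, nElt, tElt, ← map_mul, Ideal.Quotient.mk_eq_mk_iff_sub_mem]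
  exact Ideal.subset_span (Or.inl (Or.inr ⟨v, rfl⟩))

theorem mk_tElt_of_ne_zero (p : ℕ) [NeZero p] {v : ZMod p → ℕ} (hv : v ≠ 0) :
    Ideal.Quotient.mk (posIdeal p) (tElt p v) = 0 :=
  Ideal.Quotient.eq_zero_iff_mem.2 (Ideal.subset_span ⟨⟨v, hv⟩, rfl⟩)

/-- The map `ℤ[n, t]/(t² − p·t, n·t) → T / (t_v : v ≠ 0̄)`. -/
noncomputable def targetToQuotient (p : ℕ) [NeZero p] :
    targetRing p →+* TRing p ⧸ posIdeal p :=
  Ideal.Quotient.lift _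
    (MvPolynomial.eval₂Hom (Int.castRingHom (TRing p ⧸ posIdeal p)) fun b =>
      Ideal.Quotient.mk (posIdeal p) (cond b (tElt p 0) (nElt p))) <| by
    suffices h : Ideal.span _ ≤ RingHom.ker (MvPolynomial.eval₂Hom
        (Int.castRingHom (TRing p ⧸ posIdeal p)) fun b =>
          Ideal.Quotient.mk (posIdeal p) (cond b (tElt p 0) (nElt p))) from
      fun a ha => h ha
    rw [Ideal.span_le]
    rintro _ (rfl | rfl) <;>
      simp only [SetLike.mem_coe, RingHom.mem_ker, map_sub, map_mul, map_pow, map_natCast,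
        MvPolynomial.eval₂Hom_X', cond_true, cond_false]
    · rw [← map_pow, tElt_zero_sq, map_mul, map_natCast, sub_self]
    · rw [← map_mul, nElt_mul_tElt]
      exact mk_tElt_of_ne_zero p fun h => by simpa using congrFun h 0

theorem targetToQuotient_X (p : ℕ) [NeZero p] (b : Bool) :
    targetToQuotient p (Ideal.Quotient.mk _ (MvPolynomial.X b)) =
      Ideal.Quotient.mk (posIdeal p) (cond b (tElt p 0) (nElt p)) :=
  MvPolynomial.eval₂Hom_X' _ _ _

theorem quotientToTarget_mk (p : ℕ) [NeZero p] (a : TRing p) :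
    quotientToTarget p (Ideal.Quotient.mk (posIdeal p) a) = toTarget p a := rfl

theorem targetToQuotient_genValue_none (p : ℕ) [NeZero p] :
    targetToQuotient p (genValue p none) = Ideal.Quotient.mk (posIdeal p) (nElt p) := by
  rw [genValue_none, targetToQuotient_X, cond_false]

theorem targetToQuotient_genValue_some (p : ℕ) [NeZero p] (v : ZMod p → ℕ) :
    targetToQuotient p (genValue p (some v)) =
      Ideal.Quotient.mk (posIdeal p) (tElt p v) := by
  by_cases hv : v = 0
  · rw [hv, genValue_zero, targetToQuotient_X, cond_true]
  · rw [genValue_of_ne_zero p hv, map_zero, mk_tElt_of_ne_zero p hv]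

theorem quotientToTarget_comp_targetToQuotient (p : ℕ) [NeZero p] :
    (quotientToTarget p).comp (targetToQuotient p) = RingHom.id (targetRing p) := by
  refine Ideal.Quotient.ringHom_ext (MvPolynomial.ringHom_ext' (RingHom.ext_int _ _) ?_)
  rintro (_ | _) <;>
    simp only [RingHom.comp_apply, RingHom.id_apply, targetToQuotient_X, quotientToTarget_mk,
      cond_true, cond_false, toTarget_nElt, toTarget_tElt, genValue_none, genValue_zero]

theorem targetToQuotient_comp_quotientToTarget (p : ℕ) [NeZero p] :
    (targetToQuotient p).comp (quotientToTarget p) = RingHom.id (TRing p ⧸ posIdeal p) := by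
  refine Ideal.Quotient.ringHom_ext (Ideal.Quotient.ringHom_ext
    (MvPolynomial.ringHom_ext' (RingHom.ext_int _ _) ?_))
  rintro (_ | v)
  · change targetToQuotient p (toTarget p (nElt p)) = _
    rw [toTarget_nElt, targetToQuotient_genValue_none]
    rfl
  · change targetToQuotient p (toTarget p (tElt p v)) = _
    rw [toTarget_tElt, targetToQuotient_genValue_some]
    rfl

theorem statement7 (p : ℕ) (hp : p.Prime) [NeZero p] :
    ∃ e : (TRing p ⧸ posIdeal p) ≃+* targetRing p,
      e (Ideal.Quotient.mk (posIdeal p) (nElt p)) =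
        Ideal.Quotient.mk _ (MvPolynomial.X false) ∧
      e (Ideal.Quotient.mk (posIdeal p) (tElt p (0 : ZMod p → ℕ))) =
        Ideal.Quotient.mk _ (MvPolynomial.X true) := by
  refine ⟨RingEquiv.ofRingHom (quotientToTarget p) (targetToQuotient p)
    (quotientToTarget_comp_targetToQuotient p) (targetToQuotient_comp_quotientToTarget p),
    ?_, ?_⟩
  · rw [RingEquiv.ofRingHom_apply, quotientToTarget_mk, toTarget_nElt, genValue_none]
  · rw [RingEquiv.ofRingHom_apply, quotientToTarget_mk, toTarget_tElt, genValue_zero]
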